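/- The border pair of a generalized polymatroid is unique: if (g₁, f₁) and (g₂, f₂) are real-valued paramodular pairs on a finite set T such that Q(g₁, f₁) = Q(g₂, f₂), then f₁(A) = f₂(A) and g₁(A) = g₂(A) for every A ⊆ T. -/

import Mathlib

/-- A set function on the subsets of a finite type is submodular. -/
def Submodular {α : Type*} [DecidableEq α] [Fintype α] (f : Finset α → ℝ) : Prop :=
  ∀ A B : Finset α, f A + f B ≥ f (A ∩ B) + f (A ∪ B)

/-- A set function is supermodular if its negative is submodular. -/
def Supermodular {α : Type*} [DecidableEq α] [Fintype α] (g : Finset α → ℝ) : Prop :=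
  Submodular (fun A => -g A)

/-- A pair `(g, f)` with `g` supermodular, `f` submodular, `g ∅ = f ∅ = 0` and
satisfying the cross-inequality is paramodular. -/
def Paramodular {α : Type*} [DecidableEq α] [Fintype α] (g f : Finset α → ℝ) : Prop :=
  Supermodular g ∧ Submodular f ∧ g ∅ = 0 ∧ f ∅ = 0 ∧
    ∀ A B : Finset α, f A - g B ≥ f (A \ B) - g (B \ A)

/-- The generalized polymatroid `Q(g, f)` of a paramodular pair. -/
def gPolymatroid {α : Type*} [DecidableEq α] [Fintype α] (g f : Finset α → ℝ) :
    Set (α → ℝ) :=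
  {x | ∀ A : Finset α, g A ≤ ∑ t ∈ A, x t ∧ ∑ t ∈ A, x t ≤ f A}


def GoodOn {α : Type*} (f : Finset α → ℝ) (S : Finset α) (x : α → ℝ) : Prop :=
  (∀ B ⊆ S, ∑ t ∈ B, x t ≤ f B) ∧ ∑ t ∈ S, x t = f S

theorem goodOn_extend {α : Type*} [DecidableEq α] [Fintype α] (f : Finset α → ℝ)
    (hf : Submodular f) (S : Finset α) (x : α → ℝ) (hx : GoodOn f S x) (U : Finset α) :
    ∃ y, GoodOn f (S ∪ U) y ∧ ∀ t ∈ S, y t = x t := by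
  induction U using Finset.induction_on with
  | empty => exact ⟨x, by simpa using hx, fun _ _ => rfl⟩
  | insert a U _ ih =>
    obtain ⟨y, ⟨hy1, hy2⟩, hyx⟩ := ih
    rw [Finset.union_insert]
    by_cases ha : a ∈ S ∪ U
    · rw [Finset.insert_eq_of_mem ha]
      exact ⟨y, ⟨hy1, hy2⟩, hyx⟩
    generalize hV : S ∪ U = V at *
    have hz : ∀ B : Finset α, a ∉ B →
        ∑ t ∈ B, Function.update y a (f (insert a V) - f V) t = ∑ t ∈ B, y t := by
      intro B hB
      apply Finset.sum_congr rfl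
      intro t ht
      rw [Function.update_of_ne]
      rintro rfl
      exact hB ht
    refine ⟨Function.update y a (f (insert a V) - f V), ⟨?_, ?_⟩, ?_⟩
    · intro B hB
      by_cases haB : a ∈ B
      · have hsub : B.erase a ⊆ V := by
          intro t ht
          have := hB (Finset.mem_of_mem_erase ht)
          have h2 := Finset.ne_of_mem_erase ht
          simpa [h2] using this
        rw [← Finset.add_sum_erase B _ haB, hz _ (Finset.notMem_erase a B),
          Function.update_self]
        have h1 := hy1 _ hsub
        have h2 := hf B V
        have e1 : B ∩ V = B.erase a := by
          ext t
          have := @hB t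
          have := @hsub t
          simp only [Finset.mem_inter, Finset.mem_erase, Finset.mem_insert] at *
          grind
        have e2 : B ∪ V = insert a V := by
          ext t
          have := @hB t
          simp only [Finset.mem_union, Finset.mem_insert] at *
          grind
        rw [e1, e2] at h2
        linarith
      · rw [hz B haB]
        exact hy1 B ((Finset.subset_insert_iff_of_notMem haB).1 hB)
    · rw [Finset.sum_insert ha, hz V ha, Function.update_self, hy2]
      ring
    · intro t ht
      rw [Function.update_of_ne, hyx t ht]
      rintro rfl
      exact ha (hV ▸ Finset.mem_union_left _ ht)

theorem exists_tight {α : Type*} [DecidableEq α] [Fintype α] (g f : Finset α → ℝ)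
    (h : Paramodular g f) (A : Finset α) :
    ∃ x ∈ gPolymatroid g f, ∑ t ∈ A, x t = f A := by
  obtain ⟨_, hf, hg0, hf0, hc⟩ := h
  have h0 : GoodOn f ∅ (fun _ => (0 : ℝ)) := by
    refine ⟨fun B hB => ?_, by simp [hf0]⟩
    rw [Finset.subset_empty.1 hB]
    simp [hf0]
  obtain ⟨x, hx, _⟩ := goodOn_extend f hf ∅ _ h0 A
  rw [Finset.empty_union] at hx
  obtain ⟨y, hy, hyx⟩ := goodOn_extend f hf A x hx Finset.univ
  rw [Finset.union_eq_right.2 (Finset.subset_univ A)] at hy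
  refine ⟨y, fun B => ⟨?_, hy.1 B (Finset.subset_univ B)⟩, ?_⟩
  · have h1 := hc Finset.univ B
    have h2 := hy.1 (Finset.univ \ B) (Finset.subset_univ _)
    have h3 := hy.2
    rw [← Finset.sum_sdiff (Finset.subset_univ B)] at h3
    rw [Finset.sdiff_eq_empty_iff_subset.2 (Finset.subset_univ B), hg0] at h1
    linarith
  · rw [Finset.sum_congr rfl hyx]
    exact hx.2

theorem exists_tight_lower {α : Type*} [DecidableEq α] [Fintype α] (g f : Finset α → ℝ)
    (h : Paramodular g f) (A : Finset α) :
    ∃ x ∈ gPolymatroid g f, ∑ t ∈ A, x t = g A := by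
  obtain ⟨hg, hf, hg0, hf0, hc⟩ := h
  have h' : Paramodular (fun A => - f A) (fun A => - g A) := by
    refine ⟨?_, hg, by simp [hf0], by simp [hg0], fun A B => ?_⟩
    · intro A B
      have := hf A B
      simpa using this
    · have := hc B A
      simp only
      linarith
  obtain ⟨x, hx, hxA⟩ := exists_tight _ _ h' A
  refine ⟨fun t => - x t, fun B => ?_, ?_⟩
  · have := hx B
    simp only [Finset.sum_neg_distrib] at *
    constructor <;> linarith [this.1, this.2]
  · simp only [Finset.sum_neg_distrib] at *
    linarith

/-- The border pair of a generalized polymatroid is unique: two paramodular pairs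
defining the same generalized polymatroid coincide. -/
theorem gPolymatroid_border_pair_unique {α : Type*} [DecidableEq α] [Fintype α]
    (g₁ f₁ g₂ f₂ : Finset α → ℝ) (h₁ : Paramodular g₁ f₁) (h₂ : Paramodular g₂ f₂)
    (hQ : gPolymatroid g₁ f₁ = gPolymatroid g₂ f₂) :
    ∀ A : Finset α, f₁ A = f₂ A ∧ g₁ A = g₂ A := by
  intro A
  obtain ⟨x, hx, hxA⟩ := exists_tight _ _ h₁ A
  obtain ⟨y, hy, hyA⟩ := exists_tight _ _ h₂ A
  obtain ⟨z, hz, hzA⟩ := exists_tight_lower _ _ h₁ A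
  obtain ⟨w, hw, hwA⟩ := exists_tight_lower _ _ h₂ A
  rw [hQ] at hx hz
  rw [← hQ] at hy hw
  have a := (hx A).2
  have b := (hy A).2
  have c := (hz A).1
  have d := (hw A).1
  constructor <;> linarith
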